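/- Let G be a hamiltonian balanced bipartite graph of order 2n ≥ 8. If e(G) > n²/2, then G is bipancyclic, i.e. G contains cycles of all even lengths from 4 up to 2n. -/

import Mathlib

namespace SimpleGraph

open Finset

section CycleConstruction

variable {V : Type*} {G : SimpleGraph V}

/-- A closed sequence of `l ≥ 3` distinct vertices with consecutive ones adjacent is a cycle. -/
lemma exists_isCycle_of_injOn {l : ℕ} (hl : 3 ≤ l) (g : ℕ → V)
    (hinj : ∀ j k, j < l → k < l → g j = g k → j = k)
    (hadj : ∀ k, k + 1 < l → G.Adj (g k) (g (k + 1))) (hclose : G.Adj (g (l - 1)) (g 0)) :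
    ∃ (v : V) (w : G.Walk v v), w.IsCycle ∧ w.length = l := by
  obtain ⟨m, rfl⟩ := Nat.exists_eq_add_of_le' hl
  have hstep : ∀ i : Fin (m + 3), G.Adj (g i) (g (i + 1 : Fin (m + 3))) := by
    intro i
    rw [Fin.val_add_one]
    split_ifs with h
    · subst h
      simpa using hclose
    · exact hadj i (by have := Fin.val_lt_last h; omega)
  let φ : cycleGraph (m + 3) →g G :=
    { toFun := fun i => g i
      map_rel' := by
        intro a b hab
        rw [cycleGraph_adj] at hab
        rcases hab with h | h
        · have := hstep b
          rw [← h, add_sub_cancel] at this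
          exact this.symm
        · have := hstep a
          rw [← h, add_sub_cancel] at this
          exact this }
  refine ⟨_, (cycleGraph.cycle m).map φ, ?_, ?_⟩
  · exact cycleGraph.isCycle_cycle.map fun a b hab => Fin.ext (hinj _ _ a.2 b.2 hab)
  · rw [Walk.length_map, cycleGraph.length_cycle]

/-- `F` runs around a cycle of length `N` in `G`: the values `F 0, …, F (N - 1)` are distinct,
consecutive values are adjacent, and `F N = F 0`. -/
structure IsCyclicEnum (G : SimpleGraph V) (N : ℕ) (F : ℕ → V) : Prop where
  inj : ∀ a b, a < N → b < N → F a = F b → a = b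
  adj : ∀ a, G.Adj (F a) (F (a + 1))
  closed : F N = F 0

namespace IsCyclicEnum

variable {N l : ℕ} {F : ℕ → V}

/-- Follow positions `p 0, …, p (l - 1)` along an enumerated cycle, using steps of the cycle and
chords. -/
lemma exists_isCycle (hF : IsCyclicEnum G N F) (hl : 3 ≤ l) (p : ℕ → ℕ)
    (hlt : ∀ k, k < l → p k < N) (hinj : ∀ j k, j < l → k < l → p j = p k → j = k)
    (hadj : ∀ k, k + 1 < l → p (k + 1) = p k + 1 ∨ p k = p (k + 1) + 1 ∨
      G.Adj (F (p k)) (F (p (k + 1))))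
    (hclose : G.Adj (F (p (l - 1))) (F (p 0))) :
    ∃ (v : V) (w : G.Walk v v), w.IsCycle ∧ w.length = l := by
  refine exists_isCycle_of_injOn hl (F ∘ p) ?_ ?_ hclose
  · exact fun j k hj hk h => hinj j k hj hk (hF.inj _ _ (hlt j hj) (hlt k hk) h)
  · intro k hk
    rcases hadj k hk with h | h | h
    · simpa [h] using hF.adj (p k)
    · simpa [h] using (hF.adj (p (k + 1))).symm
    · exact h

lemma adj_zero_of_succ_eq (hF : IsCyclicEnum G N F) {a : ℕ} (ha : a + 1 = N) :
    G.Adj (F a) (F 0) := by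
  rw [← hF.closed, ← ha]
  exact hF.adj a

/-- Two non-crossing chords. -/
lemma exists_isCycle_of_disjoint (hF : IsCyclicEnum G N F) (hl : 3 ≤ l) {D r d : ℕ}
    (hD : 0 < D) (hd : 0 < d) (hDr : D ≤ r) (hr : r + d ≤ N) (hlen : l + D + d = N + 2)
    (h₁ : G.Adj (F 0) (F D)) (h₂ : G.Adj (F r) (F (r + d))) :
    ∃ (v : V) (w : G.Walk v v), w.IsCycle ∧ w.length = l := by
  let p : ℕ → ℕ := fun k =>
    if k = 0 then 0 else if k ≤ r - D + 1 then D + k - 1 else k + D + d - 2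
  refine hF.exists_isCycle hl p ?_ ?_ ?_ ?_
  · intro k hk; simp only [p]; split_ifs <;> omega
  · intro j k hj hk; simp only [p]; split_ifs <;> omega
  · intro k hk
    have : (p k = 0 ∧ p (k + 1) = D) ∨ (p k = r ∧ p (k + 1) = r + d) ∨ p (k + 1) = p k + 1 := by
      simp only [p]; split_ifs <;> grind
    rcases this with ⟨ha, hb⟩ | ⟨ha, hb⟩ | h
    · rw [ha, hb]; exact .inr (.inr h₁)
    · rw [ha, hb]; exact .inr (.inr h₂)
    · exact .inl h
  · have : p 0 = 0 ∧ ((p (l - 1) = r ∧ r + d = N) ∨ p (l - 1) + 1 = N) := by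
      simp only [p]; split_ifs <;> omega
    obtain ⟨h0, ⟨ha, hb⟩ | h⟩ := this
    · rw [h0, ha, ← hF.closed, ← hb]; exact h₂
    · rw [h0]; exact hF.adj_zero_of_succ_eq h

/-- Two crossing chords, avoiding the two arcs that join endpoints of like position. -/
lemma exists_isCycle_of_crossing_compl (hF : IsCyclicEnum G N F) (hl : 3 ≤ l) {D c d : ℕ}
    (hc : 0 < c) (hcD : c ≤ D) (hDc : D < c + d) (hd : c + d ≤ N)
    (hlen : l + 2 * c + d = N + D + 2)
    (h₁ : G.Adj (F 0) (F D)) (h₂ : G.Adj (F c) (F (c + d))) :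
    ∃ (v : V) (w : G.Walk v v), w.IsCycle ∧ w.length = l := by
  let p : ℕ → ℕ := fun k =>
    if k = 0 then 0 else if k ≤ D - c + 1 then D + 1 - k else k + 2 * c + d - D - 2
  refine hF.exists_isCycle hl p ?_ ?_ ?_ ?_
  · intro k hk; simp only [p]; split_ifs <;> omega
  · intro j k hj hk; simp only [p]; split_ifs <;> omega
  · intro k hk
    have : (p k = 0 ∧ p (k + 1) = D) ∨ (p k = c ∧ p (k + 1) = c + d) ∨
        p (k + 1) = p k + 1 ∨ p k = p (k + 1) + 1 := by
      simp only [p]; split_ifs <;> grind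
    rcases this with ⟨ha, hb⟩ | ⟨ha, hb⟩ | h | h
    · rw [ha, hb]; exact .inr (.inr h₁)
    · rw [ha, hb]; exact .inr (.inr h₂)
    · exact .inl h
    · exact .inr (.inl h)
  · have : p 0 = 0 ∧ ((p (l - 1) = c ∧ c + d = N) ∨ p (l - 1) + 1 = N) := by
      simp only [p]; split_ifs <;> omega
    obtain ⟨h0, ⟨ha, hb⟩ | h⟩ := this
    · rw [h0, ha, ← hF.closed, ← hb]; exact h₂
    · rw [h0]; exact hF.adj_zero_of_succ_eq h

/-- Two crossing chords, using the two arcs that join endpoints of like position. -/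
lemma exists_isCycle_of_crossing (hF : IsCyclicEnum G N F) (hl : 3 ≤ l) {D c d : ℕ}
    (hc : 0 < c) (hcD : c < D) (hDc : D ≤ c + d) (hd : c + d < N)
    (hlen : l + D = 2 * c + d + 2)
    (h₁ : G.Adj (F 0) (F D)) (h₂ : G.Adj (F c) (F (c + d))) :
    ∃ (v : V) (w : G.Walk v v), w.IsCycle ∧ w.length = l := by
  let p : ℕ → ℕ := fun k =>
    if k = 0 then 0 else if k ≤ c + d - D + 1 then D + k - 1 else 2 * c + d + 2 - D - k
  refine hF.exists_isCycle hl p ?_ ?_ ?_ ?_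
  · intro k hk; simp only [p]; split_ifs <;> omega
  · intro j k hj hk; simp only [p]; split_ifs <;> omega
  · intro k hk
    have : (p k = 0 ∧ p (k + 1) = D) ∨ (p k = c + d ∧ p (k + 1) = c) ∨
        p (k + 1) = p k + 1 ∨ p k = p (k + 1) + 1 := by
      simp only [p]; split_ifs <;> grind
    rcases this with ⟨ha, hb⟩ | ⟨ha, hb⟩ | h | h
    · rw [ha, hb]; exact .inr (.inr h₁)
    · rw [ha, hb]; exact .inr (.inr h₂.symm)
    · exact .inl h
    · exact .inr (.inl h)
  · have : p 0 = 0 ∧ p (l - 1) = 1 := by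
      simp only [p]; split_ifs <;> omega
    rw [this.1, this.2]
    exact (hF.adj 0).symm

/-- Two crossing chords of equal length `d` followed by a third chord of length `d`. -/
lemma exists_isCycle_of_triple (hF : IsCyclicEnum G N F) (hl : 3 ≤ l) {d c : ℕ}
    (hc : 0 < c) (hcd : c ≤ d) (hd : c + 2 * d + 1 < N) (hlen : l + 2 * c + d = N + 3)
    (h₁ : G.Adj (F 0) (F d)) (h₂ : G.Adj (F c) (F (c + d)))
    (h₃ : G.Adj (F (c + d + 1)) (F (c + d + 1 + d))) :
    ∃ (v : V) (w : G.Walk v v), w.IsCycle ∧ w.length = l := by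
  let p : ℕ → ℕ := fun k =>
    if k = 0 then 0 else if k ≤ d - c + 1 then d + 1 - k else
      if k ≤ d - c + 3 then k + 2 * c - 2 else k + 2 * c + d - 3
  refine hF.exists_isCycle hl p ?_ ?_ ?_ ?_
  · intro k hk; simp only [p]; split_ifs <;> omega
  · intro j k hj hk; simp only [p]; split_ifs <;> omega
  · intro k hk
    have : (p k = 0 ∧ p (k + 1) = d) ∨ (p k = c ∧ p (k + 1) = c + d) ∨
        (p k = c + d + 1 ∧ p (k + 1) = c + d + 1 + d) ∨
        p (k + 1) = p k + 1 ∨ p k = p (k + 1) + 1 := by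
      simp only [p]; split_ifs <;> grind
    rcases this with ⟨ha, hb⟩ | ⟨ha, hb⟩ | ⟨ha, hb⟩ | h | h
    · rw [ha, hb]; exact .inr (.inr h₁)
    · rw [ha, hb]; exact .inr (.inr h₂)
    · rw [ha, hb]; exact .inr (.inr h₃)
    · exact .inl h
    · exact .inr (.inl h)
  · have : p 0 = 0 ∧ p (l - 1) + 1 = N := by
      simp only [p]; split_ifs <;> omega
    rw [this.1]
    exact hF.adj_zero_of_succ_eq this.2

end IsCyclicEnum

end CycleConstruction

section Chords

variable {V : Type*} {G : SimpleGraph V} {N : ℕ}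

lemma isCyclicEnum_shift {f : ZMod N → V} (hinj : Function.Injective f)
    (hadj : ∀ x, G.Adj (f x) (f (x + 1))) (x : ZMod N) :
    IsCyclicEnum G N (fun a : ℕ => f (x + a)) where
  inj a b ha hb h := by
    have := add_left_cancel (hinj h)
    rw [ZMod.natCast_eq_natCast_iff'] at this
    rwa [Nat.mod_eq_of_lt ha, Nat.mod_eq_of_lt hb] at this
  adj a := by
    have := hadj (x + a)
    simpa [add_assoc] using this
  closed := by simp

open Classical in
/-- The starting points of the chords of length `d` of the cyclic sequence `f`. -/
noncomputable def chords (G : SimpleGraph V) [NeZero N] (f : ZMod N → V) (d : ZMod N) :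
    Finset (ZMod N) :=
  {x | G.Adj (f x) (f (x + d))}

variable [NeZero N] {f : ZMod N → V}

@[simp]
lemma mem_chords {d x : ZMod N} : x ∈ chords G f d ↔ G.Adj (f x) (f (x + d)) := by
  simp [chords]

lemma card_chords_neg (d : ZMod N) : #(chords G f (-d)) = #(chords G f d) := by
  refine Finset.card_bij (fun x _ => x - d) ?_ ?_ ?_
  · intro x hx
    rw [mem_chords] at hx ⊢
    simpa [sub_eq_add_neg] using hx.symm
  · intro x _ y _ h
    exact sub_left_injective h
  · intro y hy
    rw [mem_chords] at hy
    refine ⟨y + d, ?_, by simp⟩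
    simpa using hy.symm

lemma card_chords_one (hadj : ∀ x, G.Adj (f x) (f (x + 1))) : #(chords G f 1) = N := by
  have : chords G f 1 = univ := by
    ext x
    simp [hadj x]
  rw [this, Finset.card_univ, ZMod.card]

/-- Sets of which no member of the one is a translate by `r` of a member of the other. -/
lemma card_add_card_le_of_shift {A B : Finset (ZMod N)} (r : ZMod N)
    (h : ∀ x ∈ A, x + r ∉ B) : #A + #B ≤ N := by
  have hd : Disjoint (A.map (addRightEmbedding r)) B := by
    rw [Finset.disjoint_left]
    intro y hy
    obtain ⟨x, hx, rfl⟩ := Finset.mem_map.1 hy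
    exact h x hx
  have := Finset.card_le_univ ((A.map (addRightEmbedding r)) ∪ B)
  rwa [Finset.card_union_of_disjoint hd, Finset.card_map, ZMod.card] at this

/-- If nonempty sets are such that no member of `A` follows a member of `B` at a distance in an
interval of length `m + 1`, then their sizes sum to at most `N - m`. -/
lemma card_add_card_add_le {A B : Finset (ZMod N)} (hA : A.Nonempty) (hB : B.Nonempty)
    (s : ZMod N) (m : ℕ) (h : ∀ b ∈ B, ∀ t : ℕ, t ≤ m → b + s + t ∉ A) :
    #A + #B + m ≤ N := by
  induction m generalizing B with
  | zero =>
    have := card_add_card_le_of_shift (A := B) (B := A) s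
      (fun x hx => by simpa using h x hx 0 le_rfl)
    omega
  | succ m ih =>
    set C := B ∪ B.map (addRightEmbedding 1) with hC
    have hBC : B ⊆ C := Finset.subset_union_left
    have hne : B ≠ C := by
      intro heq
      have hstep : ∀ b ∈ B, b + 1 ∈ B := by
        intro b hb
        rw [heq, hC]
        exact Finset.mem_union_right _ (Finset.mem_map_of_mem (addRightEmbedding 1) hb)
      obtain ⟨b, hb⟩ := hB
      obtain ⟨a, ha⟩ := hA
      have hall : ∀ k : ℕ, b + k ∈ B := by
        intro k
        induction k with
        | zero => simpa using hb
        | succ k ihk => simpa [add_assoc] using hstep _ ihk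
      have hmem := hall (a - s - b).val
      rw [ZMod.natCast_zmod_val] at hmem
      refine h _ hmem 0 (Nat.zero_le _) ?_
      convert ha using 1
      simp
    have hlt := Finset.card_lt_card (Finset.ssubset_iff_subset_ne.2 ⟨hBC, hne⟩)
    have := ih (B := C) (hB.mono hBC) ?_
    · omega
    · intro c hc t ht
      rcases Finset.mem_union.1 hc with hc | hc
      · exact h c hc t (by omega)
      · obtain ⟨b, hb, rfl⟩ := Finset.mem_map.1 hc
        have := h b hb (t + 1) (by omega)
        convert this using 2
        simp only [addRightEmbedding_apply]
        push_cast
        abel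

/-- If no three members of `A` are `a, a + r, a + s`, then `A` contains at most two thirds of the
points. -/
lemma three_mul_card_le {A : Finset (ZMod N)} (r s : ZMod N)
    (h : ∀ x, x ∈ A → x + r ∈ A → x + s ∉ A) : 3 * #A ≤ 2 * N := by
  have hsum : ∀ t : ZMod N, ∑ x, (if x + t ∈ A then 1 else 0) = #A := by
    intro t
    exact (Equiv.sum_comp (Equiv.addRight t) (fun x => if x ∈ A then 1 else 0)).trans (by simp)
  have hle : ∑ x : ZMod N, ((if x + 0 ∈ A then 1 else 0) + (if x + r ∈ A then 1 else 0) +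
      (if x + s ∈ A then 1 else 0)) ≤ ∑ _x : ZMod N, 2 := by
    refine Finset.sum_le_sum fun x _ => ?_
    have := h x
    rw [add_zero]
    split_ifs <;> simp_all
  rw [Finset.sum_add_distrib, Finset.sum_add_distrib, hsum, hsum, hsum, Finset.sum_const,
    Finset.card_univ, ZMod.card, smul_eq_mul] at hle
  omega

section NoCycle

variable {l : ℕ}

/-- If a chord of length `D` followed by one of length `d` closes a cycle of the missing length
`l`, then there are at most `N` chords of these lengths. -/
lemma card_chords_add_le_of_disjoint (hinj : Function.Injective f)
    (hadj : ∀ x, G.Adj (f x) (f (x + 1))) (hl : 3 ≤ l)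
    (hno : ¬ ∃ (v : V) (w : G.Walk v v), w.IsCycle ∧ w.length = l) {D d : ℕ}
    (hD : 0 < D) (hd : 0 < d) (hlen : l + D + d = N + 2) :
    #(chords G f D) + #(chords G f d) ≤ N := by
  refine card_add_card_le_of_shift (D : ZMod N) fun x hx hy => hno ?_
  rw [mem_chords] at hx hy
  refine (isCyclicEnum_shift hinj hadj x).exists_isCycle_of_disjoint hl (D := D) (r := D)
    (d := d) hD hd le_rfl (by omega) hlen ?_ ?_
  · simpa using hx
  · simpa [add_assoc] using hy

/-- If the lengths `D` and `d` sum to the missing cycle length, then there are at most `N` chords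
of these lengths. -/
lemma card_chords_add_le_of_add_eq (hinj : Function.Injective f)
    (hadj : ∀ x, G.Adj (f x) (f (x + 1))) (hl : 3 ≤ l) (hlN : l ≤ N)
    (hno : ¬ ∃ (v : V) (w : G.Walk v v), w.IsCycle ∧ w.length = l) {D d : ℕ}
    (hD : 0 < D) (hd : 0 < d) (hlen : D + d = l) :
    #(chords G f D) + #(chords G f d) ≤ N := by
  wlog hdD : d ≤ D generalizing d D
  · rw [add_comm]
    exact this hd hD (by omega) (by omega)
  refine card_add_card_le_of_shift ((D - 1 : ℕ) : ZMod N) fun x hx hy => hno ?_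
  rw [mem_chords] at hx hy
  refine (isCyclicEnum_shift hinj hadj x).exists_isCycle_of_crossing hl (D := D) (c := D - 1)
    (d := d) (by omega) (by omega) (by omega) (by omega) (by omega) ?_ ?_
  · simpa using hx
  · simpa [add_assoc] using hy

lemma two_mul_card_chords_le_of_crossing (hinj : Function.Injective f)
    (hadj : ∀ x, G.Adj (f x) (f (x + 1))) (hl : 3 ≤ l)
    (hno : ¬ ∃ (v : V) (w : G.Walk v v), w.IsCycle ∧ w.length = l) {c d : ℕ}
    (hc : 0 < c) (hcd : c < d) (hd : c + d < N) (hlen : l = 2 * c + 2) :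
    2 * #(chords G f d) ≤ N := by
  rw [two_mul]
  refine card_add_card_le_of_shift (c : ZMod N) fun x hx hy => hno ?_
  rw [mem_chords] at hx hy
  refine (isCyclicEnum_shift hinj hadj x).exists_isCycle_of_crossing hl (D := d) (c := c)
    (d := d) hc hcd (by omega) hd (by omega) ?_ ?_
  · simpa using hx
  · simpa [add_assoc] using hy

lemma two_mul_card_chords_le_of_crossing_compl (hinj : Function.Injective f)
    (hadj : ∀ x, G.Adj (f x) (f (x + 1))) (hl : 3 ≤ l)
    (hno : ¬ ∃ (v : V) (w : G.Walk v v), w.IsCycle ∧ w.length = l) {c d : ℕ}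
    (hc : 0 < c) (hcd : c ≤ d) (hd : c + d ≤ N) (hlen : l + 2 * c = N + 2) :
    2 * #(chords G f d) ≤ N := by
  rw [two_mul]
  refine card_add_card_le_of_shift (c : ZMod N) fun x hx hy => hno ?_
  rw [mem_chords] at hx hy
  refine (isCyclicEnum_shift hinj hadj x).exists_isCycle_of_crossing_compl hl (D := d) (c := c)
    (d := d) hc hcd (by omega) hd (by omega) ?_ ?_
  · simpa using hx
  · simpa [add_assoc] using hy

lemma three_mul_card_chords_le (hinj : Function.Injective f)
    (hadj : ∀ x, G.Adj (f x) (f (x + 1))) (hl : 3 ≤ l)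
    (hno : ¬ ∃ (v : V) (w : G.Walk v v), w.IsCycle ∧ w.length = l) {c d : ℕ}
    (hc : 0 < c) (hcd : c ≤ d) (hd : c + 2 * d + 1 < N) (hlen : l + 2 * c + d = N + 3) :
    3 * #(chords G f d) ≤ 2 * N := by
  refine three_mul_card_le (c : ZMod N) ((c + d + 1 : ℕ) : ZMod N) fun x hx hy hz => hno ?_
  rw [mem_chords] at hx hy hz
  refine (isCyclicEnum_shift hinj hadj x).exists_isCycle_of_triple hl (c := c)
    (d := d) hc hcd hd hlen ?_ ?_ ?_
  · simpa using hx
  · simpa [add_assoc] using hy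
  · simpa [add_assoc] using hz

/-- If chords of lengths `d` and `D` both occur, then each chord of length `D` excludes chords of
length `d` at a whole interval of positions. -/
lemma card_chords_add_add_le (hinj : Function.Injective f)
    (hadj : ∀ x, G.Adj (f x) (f (x + 1))) (hl : 3 ≤ l)
    (hno : ¬ ∃ (v : V) (w : G.Walk v v), w.IsCycle ∧ w.length = l) {D d : ℕ}
    (hd : 0 < d) (hdD : d ≤ D) (hD : 1 < D) (hlen : l + D + d = N + 2)
    (hsum : D + d = l)
    (hDne : (chords G f D).Nonempty) (hdne : (chords G f d).Nonempty) :
    #(chords G f d) + #(chords G f D) + (N - l + 1) ≤ N := by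
  refine card_add_card_add_le hdne hDne ((D - 1 : ℕ) : ZMod N) _ fun x hx t ht hy => hno ?_
  rw [mem_chords] at hx hy
  rcases Nat.eq_zero_or_pos t with rfl | htpos
  · refine (isCyclicEnum_shift hinj hadj x).exists_isCycle_of_crossing hl (D := D) (c := D - 1)
      (d := d) (by omega) (by omega) (by omega) (by omega) (by omega) ?_ ?_
    · simpa using hx
    · simpa [add_assoc] using hy
  · refine (isCyclicEnum_shift hinj hadj x).exists_isCycle_of_disjoint hl (D := D)
      (r := D - 1 + t) (d := d) (by omega) hd (by omega) (by omega) hlen ?_ ?_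
    · simpa using hx
    · simpa [add_assoc] using hy

end NoCycle

/-- The handshaking lemma, sorted by the lengths of the chords of a spanning cyclic sequence. -/
lemma two_mul_ncard_edgeSet_eq_sum_chords [Fintype V] (hf : Function.Bijective f) :
    2 * G.edgeSet.ncard = ∑ d, #(chords G f d) := by
  classical
  have hdeg : ∀ x, G.degree (f x) = ∑ d, if G.Adj (f x) (f (x + d)) then 1 else 0 := by
    intro x
    rw [← card_neighborFinset_eq_degree, neighborFinset_eq_filter, Finset.card_filter]
    exact (((Equiv.addLeft x).trans (Equiv.ofBijective f hf)).sum_comp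
      (fun w => if G.Adj (f x) w then 1 else 0)).symm
  have hE : G.edgeSet.ncard = #G.edgeFinset := Set.ncard_eq_toFinset_card' _
  rw [hE, ← sum_degrees_eq_twice_card_edges,
    ← (Equiv.ofBijective f hf).sum_comp (fun v => G.degree v)]
  refine (Finset.sum_congr rfl fun x _ => hdeg x).trans ?_
  rw [Finset.sum_comm]
  refine Finset.sum_congr rfl fun d _ => ?_
  rw [← Finset.card_filter]
  congr 1

/-- A two-coloring forbids chords of even length. -/
lemma card_chords_two_mul (hadj : ∀ x, G.Adj (f x) (f (x + 1))) {p : V → Prop}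
    (hp : ∀ u v, G.Adj u v → (p u ↔ ¬ p v)) (k : ℕ) :
    #(chords G f ((2 * k : ℕ) : ZMod N)) = 0 := by
  have hpar : ∀ x, p (f (x + ((2 * k : ℕ) : ZMod N))) ↔ p (f x) := by
    intro x
    induction k with
    | zero => simp
    | succ k ih =>
      have h₁ := hp _ _ (hadj (x + ((2 * k : ℕ) : ZMod N)))
      have h₂ := hp _ _ (hadj (x + ((2 * k : ℕ) : ZMod N) + 1))
      have heq : x + ((2 * (k + 1) : ℕ) : ZMod N) = x + ((2 * k : ℕ) : ZMod N) + 1 + 1 := by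
        push_cast
        ring
      rw [heq]
      tauto
  rw [Finset.card_eq_zero, Finset.eq_empty_iff_forall_notMem]
  intro x hx
  have h₁ := hp _ _ (mem_chords.1 hx)
  have h₂ := hpar x
  tauto

end Chords

section Sums

lemma sum_range_two_mul (n : ℕ) (g : ℕ → ℕ) :
    ∑ i ∈ range (2 * n), g i = ∑ k ∈ range n, (g (2 * k) + g (2 * k + 1)) := by
  induction n with
  | zero => simp
  | succ n ih =>
    rw [Finset.sum_range_succ, ← ih, mul_add, mul_one, Finset.sum_range_succ,
      Finset.sum_range_succ]
    omega

lemma two_mul_sum_range_eq (m : ℕ) (a : ℕ → ℕ) :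
    2 * ∑ k ∈ range m, a k = ∑ k ∈ range m, (a k + a (m - 1 - k)) := by
  rw [Finset.sum_add_distrib, Finset.sum_range_reflect, two_mul]

/-- A symmetric sequence of length `n` whose outer blocks have paired average at most `n` and whose
middle terms are at most `n` has sum at most `n ^ 2`. -/
lemma sum_range_le_sq {m n : ℕ} (hm : 2 * m ≤ n) (a : ℕ → ℕ)
    (hsymm : ∀ k, k < n → a (n - 1 - k) = a k)
    (hpair : ∀ k, k < m → a k + a (m - 1 - k) ≤ 2 * n)
    (hmid : ∀ k, m ≤ k → k < n - m → a k ≤ n) :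
    ∑ k ∈ range n, a k ≤ n ^ 2 := by
  obtain ⟨q, rfl⟩ := Nat.exists_eq_add_of_le hm
  have hhead : 2 * ∑ k ∈ range m, a k ≤ m * (2 * (2 * m + q)) := by
    rw [two_mul_sum_range_eq]
    refine (Finset.sum_le_card_nsmul _ _ _ fun k hk => hpair k (Finset.mem_range.1 hk)).trans ?_
    simp
  have htail : ∑ k ∈ range m, a (m + q + k) = ∑ k ∈ range m, a k := by
    rw [← Finset.sum_range_reflect]
    refine Finset.sum_congr rfl fun k hk => ?_
    rw [Finset.mem_range] at hk
    rw [← hsymm k (by omega)]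
    congr 1
    omega
  have hmiddle : ∑ k ∈ range q, a (m + k) ≤ q * (2 * m + q) := by
    refine (Finset.sum_le_card_nsmul _ _ (2 * m + q) fun k hk => ?_).trans (by simp)
    rw [Finset.mem_range] at hk
    exact hmid _ (by omega) (by omega)
  have hsplit : ∑ k ∈ range (2 * m + q), a k =
      ∑ k ∈ range m, a k + ∑ k ∈ range q, a (m + k) + ∑ k ∈ range m, a (m + q + k) := by
    rw [← Finset.sum_range_add, ← Finset.sum_range_add]
    congr 2
    omega
  rw [hsplit, htail]
  nlinarith

end Sums

section Bipancyclic

variable {V : Type*} {G : SimpleGraph V}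

/-- A closed walk through all vertices that is a cycle gives a cyclic enumeration of the
vertices. -/
lemma Walk.IsCycle.exists_bijective_zmod {v : V} {w : G.Walk v v} (hw : w.IsCycle)
    (hsupp : ∀ u, u ∈ w.support) :
    ∃ (N : ℕ) (_ : NeZero N) (f : ZMod N → V), Function.Bijective f ∧
      ∀ x, G.Adj (f x) (f (x + 1)) := by
  have hlen := hw.three_le_length
  have hne : NeZero w.length := ⟨by omega⟩
  have hone : (1 : ZMod w.length).val = 1 := ZMod.val_one'' (by omega)
  refine ⟨w.length, hne, fun x => w.getVert x.val, ⟨?_, ?_⟩, ?_⟩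
  · intro x y hxy
    have hx := ZMod.val_lt x
    have hy := ZMod.val_lt y
    exact ZMod.val_injective _
      (hw.getVert_injOn' (by simp only [Set.mem_ofPred_eq]; omega)
        (by simp only [Set.mem_ofPred_eq]; omega) hxy)
  · intro u
    obtain ⟨i, hi, hle⟩ := Walk.mem_support_iff_exists_getVert.1 (hsupp u)
    rcases hle.lt_or_eq with hlt | heq
    · exact ⟨i, by simp only [ZMod.val_cast_of_lt hlt, hi]⟩
    · refine ⟨0, ?_⟩
      rw [← hi, heq]
      simp
  · intro x
    have hx := ZMod.val_lt x
    have hadj := w.adj_getVert_succ hx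
    rcases (Nat.succ_le_of_lt hx).lt_or_eq with hlt | heq
    · have : (x + 1).val = x.val + 1 := by
        rw [ZMod.val_add_of_lt (by rw [hone]; exact hlt), hone]
      simpa only [this] using hadj
    · have : (x + 1).val = 0 := by
        rw [ZMod.val_add, hone, ← Nat.succ_eq_add_one, heq, Nat.mod_self]
      simp only [this, Walk.getVert_zero]
      rwa [← Nat.succ_eq_add_one, heq, Walk.getVert_length] at hadj

variable {N : ℕ} [NeZero N] {f : ZMod N → V} {n ℓ : ℕ}

/-- The paired sums of numbers of chords when the missing cycle length is half the order plus
one. -/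
lemma sum_card_chords_le_of_middle (hN : N = 2 * n) (hn : 4 ≤ n) (hinj : Function.Injective f)
    (hadj : ∀ x, G.Adj (f x) (f (x + 1))) (hℓ : 2 * ℓ = n + 1)
    (hno : ¬ ∃ (v : V) (w : G.Walk v v), w.IsCycle ∧ w.length = 2 * ℓ) :
    2 * ∑ k ∈ range ℓ, #(chords G f ((2 * k + 1 : ℕ) : ZMod N)) ≤ n ^ 2 := by
  obtain ⟨h, rfl⟩ : ∃ h, ℓ = h + 1 := ⟨ℓ - 1, by omega⟩
  obtain rfl : n = 2 * h + 1 := by omega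
  set a : ℕ → ℕ := fun k => #(chords G f ((2 * k + 1 : ℕ) : ZMod N)) with ha
  have hpair : ∀ k, k < h + 1 → a k + a (h - k) ≤ 4 * h + 2 := by
    intro k hk
    have := card_chords_add_le_of_add_eq hinj hadj (l := 2 * (h + 1)) (by omega) (by omega) hno
      (D := 2 * k + 1) (d := 2 * (h - k) + 1) (by omega) (by omega) (by omega)
    simp only [ha]
    omega
  change 2 * ∑ k ∈ range (h + 1), a k ≤ _
  rw [two_mul_sum_range_eq, Nat.add_sub_cancel]
  have hempty : ∀ k, ¬ (chords G f ((2 * k + 1 : ℕ) : ZMod N)).Nonempty → a k = 0 := by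
    intro k hk
    exact Finset.card_eq_zero.2 (Finset.not_nonempty_iff_eq_empty.1 hk)
  rcases Nat.even_or_odd' h with ⟨j, hj | hj⟩
  · have hmid : a j ≤ h := by
      by_cases hne : (chords G f ((2 * j + 1 : ℕ) : ZMod N)).Nonempty
      · have := card_chords_add_add_le hinj hadj (l := 2 * (h + 1)) (by omega) hno
          (D := 2 * j + 1) (d := 2 * j + 1) (by omega) le_rfl (by omega) (by omega) (by omega)
          hne hne
        simp only [ha]
        omega
      · rw [hempty j hne]
        omega
    have hsum : ∑ k ∈ range (h + 1), (a k + a (h - k) + if k = j then 2 * h + 2 else 0) ≤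
        ∑ _k ∈ range (h + 1), (4 * h + 2) := by
      refine Finset.sum_le_sum fun k hk => ?_
      split_ifs with hkj
      · rw [hkj, show h - j = j by omega]
        omega
      · exact hpair k (Finset.mem_range.1 hk)
    rw [Finset.sum_add_distrib, Finset.sum_ite_eq', if_pos (Finset.mem_range.2 (by omega)),
      Finset.sum_const, Finset.card_range, smul_eq_mul] at hsum
    nlinarith
  · have hmid : a j + a (j + 1) ≤ 3 * h + 1 := by
      by_cases hD : (chords G f ((2 * (j + 1) + 1 : ℕ) : ZMod N)).Nonempty
      · by_cases hd : (chords G f ((2 * j + 1 : ℕ) : ZMod N)).Nonempty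
        · have := card_chords_add_add_le hinj hadj (l := 2 * (h + 1)) (by omega) hno
            (D := 2 * (j + 1) + 1) (d := 2 * j + 1) (by omega) (by omega) (by omega) (by omega)
            (by omega) hD hd
          simp only [ha]
          omega
        · have := two_mul_card_chords_le_of_crossing hinj hadj (l := 2 * (h + 1)) (by omega) hno
            (c := h) (d := 2 * (j + 1) + 1) (by omega) (by omega) (by omega) (by omega)
          rw [hempty j hd]
          simp only [ha]
          omega
      · have := three_mul_card_chords_le hinj hadj (l := 2 * (h + 1)) (by omega) hno
          (c := j + 2) (d := 2 * j + 1) (by omega) (by omega) (by omega) (by omega)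
        rw [hempty (j + 1) hD]
        simp only [ha]
        omega
    have hsum : ∑ k ∈ range (h + 1), (a k + a (h - k) + ((if k = j then h + 1 else 0) +
        if k = j + 1 then h + 1 else 0)) ≤ ∑ _k ∈ range (h + 1), (4 * h + 2) := by
      refine Finset.sum_le_sum fun k hk => ?_
      by_cases hkj : k = j
      · rw [if_pos hkj, if_neg (by omega), hkj, show h - j = j + 1 by omega]
        omega
      · by_cases hkj' : k = j + 1
        · rw [if_neg hkj, if_pos hkj', hkj', show h - (j + 1) = j by omega]
          omega
        · rw [if_neg hkj, if_neg hkj']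
          exact hpair k (Finset.mem_range.1 hk)
    rw [Finset.sum_add_distrib, Finset.sum_add_distrib (f := fun k => if k = j then h + 1 else 0),
      Finset.sum_ite_eq', Finset.sum_ite_eq', if_pos (Finset.mem_range.2 (by omega)),
      if_pos (Finset.mem_range.2 (by omega)), Finset.sum_const, Finset.card_range,
      smul_eq_mul] at hsum
    nlinarith

/-- A bipartite graph with a hamiltonian cycle of length `2 * n` and without cycles of length
`2 * ℓ` has at most `n ^ 2 / 2` edges. -/
lemma two_mul_ncard_edgeSet_le_sq [Fintype V] (hN : N = 2 * n) (hn : 4 ≤ n)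
    (hf : Function.Bijective f) (hadj : ∀ x, G.Adj (f x) (f (x + 1))) {p : V → Prop}
    (hp : ∀ u v, G.Adj u v → (p u ↔ ¬ p v)) (h2 : 2 ≤ ℓ) (hℓn : ℓ ≤ n)
    (hno : ¬ ∃ (v : V) (w : G.Walk v v), w.IsCycle ∧ w.length = 2 * ℓ) :
    2 * G.edgeSet.ncard ≤ n ^ 2 := by
  have hinj := hf.injective
  set a : ℕ → ℕ := fun k => #(chords G f ((2 * k + 1 : ℕ) : ZMod N)) with ha
  have hsum : 2 * G.edgeSet.ncard = ∑ k ∈ range n, a k := by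
    have hrange : ∑ d, #(chords G f d) = ∑ i ∈ range (2 * n), #(chords G f (i : ZMod N)) := by
      refine Finset.sum_nbij' ZMod.val Nat.cast ?_ ?_ ?_ ?_ ?_
      · intro d _
        rw [Finset.mem_range, ← hN]
        exact ZMod.val_lt d
      · simp
      · intro d _
        exact ZMod.natCast_zmod_val d
      · intro i hi
        exact ZMod.val_cast_of_lt (by rw [hN]; exact Finset.mem_range.1 hi)
      · intro d _
        rw [ZMod.natCast_zmod_val]
    rw [two_mul_ncard_edgeSet_eq_sum_chords hf, hrange, sum_range_two_mul]
    refine Finset.sum_congr rfl fun k _ => ?_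
    rw [card_chords_two_mul hadj hp, zero_add]
  have hsymm : ∀ k, k < n → a (n - 1 - k) = a k := by
    intro k hk
    have : ((2 * (n - 1 - k) + 1 : ℕ) : ZMod N) = -((2 * k + 1 : ℕ) : ZMod N) := by
      rw [eq_neg_iff_add_eq_zero, ← Nat.cast_add,
        show 2 * (n - 1 - k) + 1 + (2 * k + 1) = N by omega, ZMod.natCast_self]
    simp only [ha, this, card_chords_neg]
  rw [hsum]
  rcases lt_trichotomy (2 * ℓ) (n + 1) with hlt | heq | hgt
  · refine sum_range_le_sq (m := ℓ) (by omega) a hsymm ?_ ?_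
    · intro k hk
      rw [← hN]
      exact card_chords_add_le_of_add_eq hinj hadj (l := 2 * ℓ) (by omega) (by omega) hno
        (by omega) (by omega) (by omega)
    · intro k hk hk'
      have := two_mul_card_chords_le_of_crossing hinj hadj (l := 2 * ℓ) (by omega) hno
        (c := ℓ - 1) (d := 2 * k + 1) (by omega) (by omega) (by omega) (by omega)
      simp only [ha]
      omega
  · have hmid := sum_card_chords_le_of_middle hN hn hinj hadj heq hno
    have hlast : a (ℓ - 1) = 0 := by
      have hle := card_chords_add_le_of_add_eq hinj hadj (l := 2 * ℓ) (by omega) (by omega) hno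
        (D := 1) (d := 2 * (ℓ - 1) + 1) (by omega) (by omega) (by omega)
      rw [Nat.cast_one, card_chords_one hadj] at hle
      simp only [ha]
      omega
    have hhead : ∑ k ∈ range ℓ, a k = ∑ k ∈ range (ℓ - 1), a k := by
      obtain ⟨h, rfl⟩ : ∃ h, ℓ = h + 1 := ⟨ℓ - 1, by omega⟩
      rw [Nat.add_sub_cancel] at hlast
      rw [Finset.sum_range_succ, Nat.add_sub_cancel, hlast, add_zero]
    have htail : ∑ k ∈ range (ℓ - 1), a (ℓ + k) = ∑ k ∈ range (ℓ - 1), a k := by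
      rw [← Finset.sum_range_reflect]
      refine Finset.sum_congr rfl fun k hk => ?_
      rw [Finset.mem_range] at hk
      rw [← hsymm k (by omega)]
      congr 1
      omega
    calc ∑ k ∈ range n, a k = ∑ k ∈ range (ℓ + (ℓ - 1)), a k := by congr 2; omega
      _ = 2 * ∑ k ∈ range ℓ, a k := by
        rw [Finset.sum_range_add, htail, ← hhead, two_mul]
      _ ≤ n ^ 2 := hmid
  · refine sum_range_le_sq (m := n + 1 - ℓ) (by omega) a hsymm ?_ ?_
    · intro k hk
      rw [← hN]
      exact card_chords_add_le_of_disjoint hinj hadj (l := 2 * ℓ) (by omega) hno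
        (by omega) (by omega) (by omega)
    · intro k hk hk'
      have := two_mul_card_chords_le_of_crossing_compl hinj hadj (l := 2 * ℓ) (by omega) hno
        (c := n + 1 - ℓ) (d := 2 * k + 1) (by omega) (by omega) (by omega) (by omega)
      simp only [ha]
      omega

end Bipancyclic

end SimpleGraph

/-- **Theorem (Entringer–Schmeichel).** Let `G` be a hamiltonian balanced bipartite graph of
order `2n ≥ 8`. If `e(G) > n²/2`, then `G` is bipancyclic: it contains a cycle of length
`2ℓ` for every `2 ≤ ℓ ≤ n`. -/
theorem stmt_19 {V : Type} [Fintype V] [DecidableEq V]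
    (G : SimpleGraph V) (X Y : Finset V) (n : ℕ)
    (hpart : ∀ v : V, v ∈ X ∨ v ∈ Y) (hdisj : Disjoint X Y)
    (hbip : ∀ u v : V, G.Adj u v → (u ∈ X ∧ v ∈ Y) ∨ (u ∈ Y ∧ v ∈ X))
    (hX : X.card = n) (hY : Y.card = n) (hn : 4 ≤ n)
    (hham : ∃ (v : V) (w : G.Walk v v), w.IsCycle ∧ ∀ u : V, u ∈ w.support)
    (he : (n : ℚ) ^ 2 / 2 < (G.edgeSet.ncard : ℚ)) :
    ∀ ℓ : ℕ, 2 ≤ ℓ → ℓ ≤ n →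
      ∃ (v : V) (w : G.Walk v v), w.IsCycle ∧ w.length = 2 * ℓ := by
  intro ℓ h2 hℓ
  by_contra hno
  obtain ⟨v, w, hw, hsupp⟩ := hham
  obtain ⟨N, _, f, hf, hadj⟩ := hw.exists_bijective_zmod hsupp
  have hN : N = 2 * n := by
    have hV : X ∪ Y = Finset.univ := by
      ext u
      simpa using hpart u
    have hcard := Fintype.card_of_bijective hf
    rw [ZMod.card, ← Finset.card_univ, ← hV, Finset.card_union_of_disjoint hdisj, hX, hY] at hcard
    omega
  have hp : ∀ u v, G.Adj u v → (u ∈ X ↔ ¬ v ∈ X) := by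
    intro u v huv
    have hu : u ∈ X → u ∉ Y := fun h => Finset.disjoint_left.1 hdisj h
    have hv : v ∈ X → v ∉ Y := fun h => Finset.disjoint_left.1 hdisj h
    have := hbip u v huv
    tauto
  have hle := G.two_mul_ncard_edgeSet_le_sq hN hn hf hadj (p := (· ∈ X)) hp h2 hℓ hno
  have hle' : (2 : ℚ) * G.edgeSet.ncard ≤ (n : ℚ) ^ 2 := by exact_mod_cast hle
  linarith
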